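/- arXiv:1802.09385 — 4 statements merged into one kernel-verified Lean document; each statement's English description precedes it below -/
import Mathlib

section
/- Let k ∈ ℕ be fixed. Then there exists a constant C > 0 such that |D_z^k(cosh(vz))| ≤ C·e^{vz}·v^{2k}·(π−z)^{-2k} for all v ≥ 1 and z ∈ (0,π); here D_z^k(cosh(vz)) denotes the k-fold application of the operator g ↦ (1/sin z)·g′(z) to the function z ↦ cosh(vz). -/
/-- The operator `g ↦ g'(z)/sin z`. -/
noncomputable def Dop (g : ℝ → ℝ) : ℝ → ℝ := fun z => deriv g z / Real.sin z

open Filter Topology in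
theorem Dop_even_step (g h : ℝ → ℝ) (hgh : g =ᶠ[𝓝[≠] 0] h) (ha : AnalyticAt ℝ h 0)
    (he : ∀ x, h (-x) = h x) :
    ∃ h' : ℝ → ℝ, Dop g =ᶠ[𝓝[≠] 0] h' ∧ AnalyticAt ℝ h' 0 ∧ ∀ x, h' (-x) = h' x := by
  have hda : AnalyticAt ℝ (deriv h) 0 := ha.deriv
  have hodd : ∀ x, deriv h (-x) = - deriv h x := by
    intro x
    have h1 : (fun y => h (-y)) = h := funext he
    have h2 := deriv_comp_neg h x
    rw [h1] at h2
    linarith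
  have h0 : deriv h 0 = 0 := by
    have := hodd 0
    simp at this
    linarith
  have hs0 : dslope Real.sin 0 0 = 1 := by simp [dslope_same]
  have A1 : AnalyticAt ℝ (dslope (deriv h) 0) 0 := by
    obtain ⟨p, hp⟩ := hda
    exact ⟨_, hp.has_fpower_series_dslope_fslope⟩
  have A2 : AnalyticAt ℝ (dslope Real.sin 0) 0 := by
    obtain ⟨p, hp⟩ := (Real.analyticAt_sin : AnalyticAt ℝ Real.sin 0)
    exact ⟨_, hp.has_fpower_series_dslope_fslope⟩
  refine ⟨fun x => dslope (deriv h) 0 x / dslope Real.sin 0 x, ?_, ?_, ?_⟩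
  · have hd : deriv g =ᶠ[𝓝[≠] 0] deriv h := by
      have := eventually_eventually_nhdsWithin.2 hgh
      filter_upwards [this, self_mem_nhdsWithin] with x hx hx0
      have hx' : g =ᶠ[𝓝 x] h := by
        rw [IsOpen.nhdsWithin_eq isOpen_compl_singleton hx0] at hx
        exact hx
      exact hx'.deriv_eq
    filter_upwards [hd, self_mem_nhdsWithin] with x hx hx0
    have hx1 : x ≠ 0 := hx0
    simp only [Dop, hx, dslope_of_ne _ hx1, slope_def_field, h0, Real.sin_zero, sub_zero]
    rw [div_div_div_cancel_right₀ hx1]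
  · exact A1.div A2 (by rw [hs0]; norm_num)
  · intro x
    by_cases hx : x = 0
    · simp [hx]
    · have hx' : -x ≠ 0 := neg_ne_zero.2 hx
      simp only [dslope_of_ne _ hx, dslope_of_ne _ hx', slope_def_field, h0, Real.sin_zero,
        sub_zero, hodd, Real.sin_neg, neg_div_neg_eq]

open Filter Topology in
theorem Dop_iter_even (v : ℝ) (k : ℕ) :
    ∃ h : ℝ → ℝ, (Dop^[k] (fun w => Real.cosh (v * w))) =ᶠ[𝓝[≠] 0] h ∧ AnalyticAt ℝ h 0 ∧
      ∀ x, h (-x) = h x := by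
  induction k with
  | zero =>
    refine ⟨fun w => Real.cosh (v * w), EventuallyEq.rfl, ?_, ?_⟩
    · fun_prop
    · intro x; simp
  | succ k ih =>
    obtain ⟨h, h1, h2, h3⟩ := ih
    rw [Function.iterate_succ_apply']
    exact Dop_even_step _ h h1 h2 h3

theorem Dop_iter_analytic (v : ℝ) (k : ℕ) (z : ℝ) (hz : Real.sin z ≠ 0) :
    AnalyticAt ℝ (Dop^[k] (fun w => Real.cosh (v * w))) z := by
  induction k with
  | zero =>
    show AnalyticAt ℝ (fun w => Real.cosh (v * w)) z
    fun_prop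
  | succ k ih =>
    rw [Function.iterate_succ_apply']
    exact ih.deriv.div Real.analyticAt_sin hz

theorem Dop_iter_hasDeriv (v : ℝ) (k : ℕ) (z : ℝ) (hz : Real.sin z ≠ 0) :
    HasDerivAt (Dop^[k] (fun w => Real.cosh (v * w)))
      (Real.sin z * (Dop^[k+1] (fun w => Real.cosh (v * w))) z) z := by
  have := (Dop_iter_analytic v k z hz).differentiableAt.hasDerivAt
  rw [Function.iterate_succ_apply']
  simp only [Dop]
  rwa [mul_div_cancel₀ _ hz]

open Filter Topology in
theorem Dop_iter_ode (v : ℝ) (k : ℕ) : ∀ z : ℝ, Real.sin z ≠ 0 →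
    Real.sin z ^ 2 * (Dop^[k+2] (fun w => Real.cosh (v * w))) z
      + (2 * k + 1) * Real.cos z * (Dop^[k+1] (fun w => Real.cosh (v * w))) z
      = (k ^ 2 + v ^ 2) * (Dop^[k] (fun w => Real.cosh (v * w))) z := by
  induction k with
  | zero =>
    intro z hz
    have e1 : Dop^[1] (fun w => Real.cosh (v * w))
        = fun w => v * Real.sinh (v * w) / Real.sin w := by
      funext w
      have : HasDerivAt (fun w => Real.cosh (v * w)) (Real.sinh (v * w) * (v * 1)) w :=
        ((hasDerivAt_id w).const_mul v).cosh
      simp only [Function.iterate_one, Dop, this.deriv]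
      ring
    have h1 := Dop_iter_hasDeriv v 1 z hz
    rw [e1] at h1
    have h2 : HasDerivAt (fun w => v * Real.sinh (v * w)) (v * (Real.cosh (v * z) * (v * 1))) z :=
      (((hasDerivAt_id z).const_mul v).sinh).const_mul v
    have h3 := h1.unique (h2.div (Real.hasDerivAt_sin z) hz)
    have e2 : (0 + 2 : ℕ) = 1 + 1 := rfl
    rw [e2, zero_add, e1]
    simp only [Function.iterate_zero, id]
    rw [pow_two, mul_assoc, h3]
    push_cast
    field_simp
    ring
  | succ k ih =>
    intro z hz
    have hev : (fun z => Real.sin z ^ 2 * (Dop^[k+2] (fun w => Real.cosh (v * w))) z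
      + (2 * k + 1) * Real.cos z * (Dop^[k+1] (fun w => Real.cosh (v * w))) z) =ᶠ[𝓝 z]
      (fun z => (k ^ 2 + v ^ 2) * (Dop^[k] (fun w => Real.cosh (v * w))) z) := by
      have : ∀ᶠ y in 𝓝 z, Real.sin y ≠ 0 := Real.continuous_sin.continuousAt.eventually_ne hz
      filter_upwards [this] with y hy using ih y hy
    have d0 := Dop_iter_hasDeriv v k z hz
    have d1 := Dop_iter_hasDeriv v (k+1) z hz
    have d2 := Dop_iter_hasDeriv v (k+2) z hz
    have L := (((Real.hasDerivAt_sin z).pow 2).mul d2).add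
      (((Real.hasDerivAt_cos z).const_mul (2 * (k:ℝ) + 1)).mul d1)
    have R := d0.const_mul ((k:ℝ) ^ 2 + v ^ 2)
    have key := L.unique (R.congr_of_eventuallyEq hev)
    have e3 : k + 1 + 2 = k + 2 + 1 := rfl
    have e4 : k + 1 + 1 = k + 2 := rfl
    rw [e3]
    rw [e4] at *
    simp only [Pi.pow_apply] at key
    push_cast at key ⊢
    apply mul_left_cancel₀ hz
    linear_combination key

theorem sin_le_aux (t : ℝ) (h0 : 0 < t) (h1 : t < Real.pi) : Real.sin t ≤ t * (Real.pi - t) := by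
  have hp := Real.pi_gt_three
  rcases le_total t (Real.pi / 2) with h | h
  · have := Real.sin_le h0.le
    nlinarith
  · have := Real.sin_le (sub_nonneg.2 h1.le)
    rw [Real.sin_pi_sub] at this
    nlinarith

theorem le_sin_aux (t : ℝ) (h0 : 0 < t) (h1 : t < Real.pi) :
    2 / Real.pi ^ 2 * (t * (Real.pi - t)) ≤ Real.sin t := by
  have hp := Real.pi_pos
  rcases le_total t (Real.pi / 2) with h | h
  · refine le_trans ?_ (Real.mul_le_sin h0.le h)
    have : 2 / Real.pi * t = 2 / Real.pi ^ 2 * (t * Real.pi) := by field_simp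
    rw [this]
    gcongr
    linarith
  · have h2 := Real.mul_le_sin (x := Real.pi - t) (by linarith) (by linarith)
    rw [Real.sin_pi_sub] at h2
    refine le_trans ?_ h2
    have : 2 / Real.pi * (Real.pi - t) = 2 / Real.pi ^ 2 * (Real.pi * (Real.pi - t)) := by
      field_simp
    rw [this]
    have : 0 ≤ Real.pi - t := by linarith
    gcongr

open Filter Topology in
theorem Dop_iter_f (v : ℝ) (k : ℕ) (f : ℝ → ℝ)
    (hf : f = fun t => Real.sin t ^ (2 * k + 1) * (Dop^[k+1] (fun w => Real.cosh (v * w))) t) :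
    ContinuousAt f 0 ∧ ∀ z, Real.sin z ≠ 0 → HasDerivAt f ((k ^ 2 + v ^ 2) *
      (Real.sin z ^ (2 * k) * (Dop^[k] (fun w => Real.cosh (v * w))) z)) z := by
  subst hf
  constructor
  · obtain ⟨h, h1, h2, -⟩ := Dop_iter_even v (k+1)
    have hc : ContinuousAt (fun t => Real.sin t ^ (2 * k + 1) * h t) 0 :=
      (Real.continuous_sin.pow _).continuousAt.mul h2.continuousAt
    refine hc.congr ?_
    rw [eventuallyEq_nhdsWithin_iff] at h1
    filter_upwards [h1] with x hx
    by_cases hx0 : x = 0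
    · simp [hx0]
    · rw [hx hx0]
  · intro z hz
    have := ((Real.hasDerivAt_sin z).pow (2*k+1)).mul (Dop_iter_hasDeriv v (k+1) z hz)
    refine this.congr_deriv ?_
    have ode := Dop_iter_ode v k z hz
    have e4 : k + 1 + 1 = k + 2 := rfl
    rw [e4]
    simp only [Pi.pow_apply, Nat.add_sub_cancel]
    push_cast
    rw [pow_succ]
    linear_combination (Real.sin z ^ (2 * k)) * ode

theorem Dop_iter_bound_aux (k : ℕ) :
    ∃ C : ℝ, 0 < C ∧
      ∀ v z : ℝ, 1 ≤ v → z ∈ Set.Ioo 0 Real.pi →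
        (Real.pi - z) ^ (2 * k) * |(Dop^[k] (fun w => Real.cosh (v * w))) z| ≤
          C * Real.exp (v * z) * v ^ (2 * k) := by
  induction k with
  | zero =>
    refine ⟨1, one_pos, ?_⟩
    intro v z hv hz
    have : Real.exp (-(v * z)) ≤ Real.exp (v * z) := by
      apply Real.exp_le_exp.2
      have := mul_pos (by linarith : 0 < v) hz.1
      linarith
    have hc := Real.cosh_pos (v * z)
    simp only [Function.iterate_zero, id, mul_zero, pow_zero, one_mul, mul_one, abs_of_pos hc]
    rw [Real.cosh_eq]
    linarith
  | succ k ih =>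
    obtain ⟨C, hC, H⟩ := ih
    have hp := Real.pi_pos
    refine ⟨(k ^ 2 + 1) * C * Real.pi / (2 / Real.pi ^ 2) ^ (2 * k + 1), by positivity, ?_⟩
    rintro v z hv ⟨hz0, hz1⟩
    obtain ⟨hc0, hder⟩ := Dop_iter_f v k _ rfl
    set G := (Dop^[k+1] (fun w => Real.cosh (v * w))) with hG
    set f : ℝ → ℝ := fun t => Real.sin t ^ (2 * k + 1) * G t with hf
    set A : ℝ := (k ^ 2 + 1) * C * Real.exp (v * z) * v ^ (2 * k + 2) with hA
    have hApos : 0 < A := by positivity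
    have hsin : ∀ t, 0 < t → t ≤ z → 0 < Real.sin t := fun t h1 h2 =>
      Real.sin_pos_of_pos_of_lt_pi h1 (by linarith)
    have hbd : ∀ t, 0 < t → t < z → |(k ^ 2 + v ^ 2) *
      (Real.sin t ^ (2 * k) * (Dop^[k] (fun w => Real.cosh (v * w))) t)|
        ≤ A * ((2 * k + 1) * t ^ (2 * k)) := by
      intro t h1 h2
      have hs := hsin t h1 h2.le
      have hq := H v t hv ⟨h1, by linarith⟩
      rw [abs_mul, abs_mul, abs_of_pos (pow_pos hs _), abs_of_pos (by positivity)]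
      have s1 : Real.sin t ^ (2 * k) ≤ t ^ (2 * k) * (Real.pi - t) ^ (2 * k) := by
        rw [← mul_pow]
        exact pow_le_pow_left₀ hs.le (sin_le_aux t h1 (by linarith)) _
      have s2 : (k:ℝ) ^ 2 + v ^ 2 ≤ (k ^ 2 + 1) * v ^ 2 := by
        have : 1 ≤ v ^ 2 := one_le_pow₀ hv
        nlinarith [sq_nonneg (k:ℝ)]
      have s3 : Real.exp (v * t) ≤ Real.exp (v * z) := by
        apply Real.exp_le_exp.2
        gcongr
      calc _ ≤ ((k ^ 2 + 1) * v ^ 2) * ((t ^ (2 * k) * (Real.pi - t) ^ (2 * k)) *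
              |(Dop^[k] (fun w => Real.cosh (v * w))) t|) := by gcongr
        _ = ((k ^ 2 + 1) * v ^ 2) * (t ^ (2 * k) * ((Real.pi - t) ^ (2 * k) *
              |(Dop^[k] (fun w => Real.cosh (v * w))) t|)) := by ring
        _ ≤ ((k ^ 2 + 1) * v ^ 2) * (t ^ (2 * k) * (C * Real.exp (v * z) * v ^ (2 * k))) := by
            have hq' : _ ≤ C * Real.exp (v * z) * v ^ (2 * k) := hq.trans (by gcongr)
            exact mul_le_mul_of_nonneg_left
              (mul_le_mul_of_nonneg_left hq' (by positivity)) (by positivity)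
        _ = A * (1 * t ^ (2 * k)) := by rw [hA]; ring
        _ ≤ _ := by
            gcongr
            have : (0:ℝ) ≤ k := Nat.cast_nonneg k
            linarith
    have hcont : ContinuousOn f (Set.Icc 0 z) := by
      intro t ht
      apply ContinuousAt.continuousWithinAt
      rcases ht.1.eq_or_lt with h | h
      · rw [← h]; exact hc0
      · exact (hder t (hsin t h ht.2).ne').continuousAt
    have hφ : ∀ t, HasDerivAt (fun t : ℝ => A * t ^ (2 * k + 1))
        (A * ((2 * k + 1) * t ^ (2 * k))) t := by
      intro t
      have := (hasDerivAt_pow (2 * k + 1) t).const_mul A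
      simpa using this
    have f0 : f 0 = 0 := by simp [hf]
    have hφc : ContinuousOn (fun t : ℝ => A * t ^ (2 * k + 1)) (Set.Icc 0 z) := by fun_prop
    have m1 : MonotoneOn (fun t => A * t ^ (2 * k + 1) - f t) (Set.Icc 0 z) := by
      apply monotoneOn_of_hasDerivWithinAt_nonneg (convex_Icc 0 z) (hφc.sub hcont)
      · intro t ht
        rw [interior_Icc] at ht
        exact ((hφ t).sub (hder t (hsin t ht.1 ht.2.le).ne')).hasDerivWithinAt
      · intro t ht
        rw [interior_Icc] at ht
        have := abs_le.1 (hbd t ht.1 ht.2)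
        linarith [this.2]
    have m2 : MonotoneOn (fun t => A * t ^ (2 * k + 1) + f t) (Set.Icc 0 z) := by
      apply monotoneOn_of_hasDerivWithinAt_nonneg (convex_Icc 0 z) (hφc.add hcont)
      · intro t ht
        rw [interior_Icc] at ht
        exact ((hφ t).add (hder t (hsin t ht.1 ht.2.le).ne')).hasDerivWithinAt
      · intro t ht
        rw [interior_Icc] at ht
        have := abs_le.1 (hbd t ht.1 ht.2)
        linarith [this.1]
    have i0 : (0:ℝ) ∈ Set.Icc 0 z := ⟨le_rfl, hz0.le⟩
    have iz : z ∈ Set.Icc 0 z := ⟨hz0.le, le_rfl⟩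
    have n1 := m1 i0 iz hz0.le
    have n2 := m2 i0 iz hz0.le
    simp only [f0] at n1 n2
    have z0 : (0:ℝ) ^ (2 * k + 1) = 0 := by simp
    rw [z0] at n1 n2
    have hfz : |f z| ≤ A * z ^ (2 * k + 1) := abs_le.2 ⟨by linarith, by linarith⟩
    have hsz := hsin z hz0 le_rfl
    have hfz' : |f z| = Real.sin z ^ (2 * k + 1) * |G z| := by
      simp only [hf]
      rw [abs_mul, abs_of_pos (pow_pos hsz _)]
    have hw : 0 < Real.pi - z := by linarith
    have low : (2 / Real.pi ^ 2 * (z * (Real.pi - z))) ^ (2 * k + 1) ≤ Real.sin z ^ (2 * k + 1) :=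
      pow_le_pow_left₀ (by positivity) (le_sin_aux z hz0 hz1) _
    have r1 : (2 / Real.pi ^ 2 * (z * (Real.pi - z))) ^ (2 * k + 1) * |G z|
        ≤ A * z ^ (2 * k + 1) := by
      refine le_trans ?_ (hfz'.symm.trans_le hfz)
      gcongr
    have r2 : (2 / Real.pi ^ 2) ^ (2 * k + 1) * ((Real.pi - z) ^ (2 * k + 1) * |G z|) ≤ A := by
      have : 0 < z ^ (2 * k + 1) := by positivity
      refine le_of_mul_le_mul_right ?_ this
      refine le_trans (le_of_eq ?_) r1
      rw [mul_pow, mul_pow]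
      ring
    have r3 : (Real.pi - z) ^ (2 * k + 1) * |G z| ≤ A / (2 / Real.pi ^ 2) ^ (2 * k + 1) := by
      rw [le_div_iff₀ (by positivity)]
      linarith
    calc (Real.pi - z) ^ (2 * (k + 1)) * |G z|
        = (Real.pi - z) * ((Real.pi - z) ^ (2 * k + 1) * |G z|) := by ring
      _ ≤ Real.pi * (A / (2 / Real.pi ^ 2) ^ (2 * k + 1)) := by
          gcongr
          linarith
      _ = _ := by rw [hA]; ring

/-- Lemma 3.4 of the paper: `|D_z^k (cosh(vz))| ≲ e^{vz} v^{2k} (π - z)^{-2k}` for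
`v ≥ 1` and `z ∈ (0, π)`. -/
theorem Dop_iter_cosh_global_bound (k : ℕ) :
    ∃ C : ℝ, 0 < C ∧
      ∀ v z : ℝ, 1 ≤ v → z ∈ Set.Ioo 0 Real.pi →
        |(Dop^[k] (fun w => Real.cosh (v * w))) z| ≤
          C * Real.exp (v * z) * v ^ (2 * k) * (Real.pi - z) ^ (-(2 * (k : ℝ))) := by
  obtain ⟨C, hC, H⟩ := Dop_iter_bound_aux k
  refine ⟨C, hC, fun v z hv hz => ?_⟩
  have hw : 0 < Real.pi - z := by linarith [hz.2]
  have e : (Real.pi - z) ^ (-(2 * (k : ℝ))) = ((Real.pi - z) ^ (2 * k))⁻¹ := by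
    rw [Real.rpow_neg hw.le, ← Real.rpow_natCast]
    push_cast
    rfl
  rw [e, ← div_eq_mul_inv, le_div_iff₀ (by positivity), mul_comm]
  exact H v z hv hz
end

section
/- Let N ≥ 1 be a fixed integer. There exist M₁ ≥ 1 and a constant C > 0 such that for all φ ∈ (0,π) and 0 < t ≤ 1 satisfying (π−φ)/t ≥ M₁: Σ_{n=1}^{∞} |(−D)^N[φ ↦ W_t(φ−2πn) + W_t(φ+2πn)](φ)| ≤ C·W_t(φ)·(π−φ)^{-N}·t^{-N}·(e^{-π²/(4t)} + e^{-π(π−φ)/t}). -/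
/-- The one-dimensional Gauss-Weierstrass kernel `W_t(x) = (4*pi*t)^(-1/2) exp(-x^2/(4t))`. -/
noncomputable def W (t x : ℝ) : ℝ :=
  (1 / Real.sqrt (4 * Real.pi * t)) * Real.exp (-x ^ 2 / (4 * t))

/-- The 2*pi-periodization of `W t` (heat kernel of the circle). -/
noncomputable def theta (t φ : ℝ) : ℝ := ∑' n : ℤ, W t (φ + 2 * Real.pi * n)

/-- The operator `f ↦ -(1/sin φ) * f'`. -/
noncomputable def negD (f : ℝ → ℝ) : ℝ → ℝ := fun φ => -(deriv f φ / Real.sin φ)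

open Metric in
lemma aux_cauchy {F : ℂ → ℂ} {c : ℂ} {r ρ B : ℝ} (hρ : 0 < ρ)
    (hF : DifferentiableOn ℂ F (ball c (r + ρ))) (hB : ∀ z ∈ ball c (r + ρ), ‖F z‖ ≤ B)
    {z : ℂ} (hz : z ∈ ball c r) : ‖deriv F z‖ ≤ B / ρ := by
  have hsub : closedBall z ρ ⊆ ball c (r + ρ) := by
    intro w hw
    rw [mem_closedBall] at hw
    rw [mem_ball] at hz ⊢
    linarith [dist_triangle w z c]
  exact Complex.norm_deriv_le_of_forall_mem_sphere_norm_le hρ (hF.diffContOnCl_ball hsub)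
    (fun w hw => hB w (hsub (sphere_subset_closedBall hw)))

lemma aux_negD {f : ℝ → ℝ} {F : ℂ → ℂ} {x : ℝ} (hF : DifferentiableAt ℂ F x)
    (hf : ∀ᶠ y in nhds x, f y = (F (y : ℂ)).re) :
    negD f x = (-(deriv F x / Complex.sin x)).re := by
  have h1 : deriv f x = (deriv F x).re := by
    rw [Filter.EventuallyEq.deriv_eq hf]
    exact (hF.hasDerivAt.real_of_complex).deriv
  rw [negD, h1, ← Complex.ofReal_sin, Complex.neg_re, Complex.div_ofReal_re]

open Metric in
lemma aux_iter2 {c : ℂ} {ρ m : ℝ} (hρ : 0 < ρ) (hm : 0 < m) (k : ℕ) :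
    ∀ (f : ℝ → ℝ) (F : ℂ → ℂ) (B : ℝ),
    (∀ z ∈ ball c ((k + 1) * ρ), m ≤ ‖Complex.sin z‖) →
    DifferentiableOn ℂ F (ball c ((k + 1) * ρ)) → (∀ z ∈ ball c ((k + 1) * ρ), ‖F z‖ ≤ B) →
    (∀ x : ℝ, (x : ℂ) ∈ ball c ((k + 1) * ρ) → f x = (F x).re) →
    ∀ x : ℝ, (x : ℂ) ∈ ball c ρ → |(negD^[k] f) x| ≤ B / (ρ * m) ^ k := by
  induction k with
  | zero =>
    intro f F B _ _ hB hf x hx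
    simp only [Nat.cast_zero, zero_add, one_mul] at *
    simp only [Function.iterate_zero, id_eq, pow_zero, div_one]
    rw [hf x hx]
    exact (Complex.abs_re_le_norm _).trans (hB _ hx)
  | succ k ih =>
    intro f F B hs hF hB hf x hx
    have he : ((k + 1 : ℕ) + 1 : ℝ) * ρ = (k + 1) * ρ + ρ := by push_cast; ring
    rw [he] at hs hF hB hf
    have hsub : ball c ((k + 1) * ρ) ⊆ ball c ((k + 1) * ρ + ρ) :=
      ball_subset_ball (by linarith)
    rw [Function.iterate_succ_apply]
    have := ih (negD f) (fun z => -(deriv F z / Complex.sin z)) (B / (ρ * m))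
      (fun z hz => hs z (hsub hz)) ?_ ?_ ?_ x hx
    · rw [pow_succ', ← div_div]; exact this
    · apply DifferentiableOn.neg
      apply DifferentiableOn.div ((hF.deriv isOpen_ball).mono hsub)
        Complex.differentiable_sin.differentiableOn
      intro z hz h0
      have := hs z (hsub hz)
      rw [h0, norm_zero] at this
      linarith
    · intro z hz
      rw [norm_neg, norm_div, ← div_div]
      have h1 := aux_cauchy hρ hF hB hz
      exact div_le_div₀ ((norm_nonneg _).trans h1) h1 hm (hs z (hsub hz))
    · intro y hy
      apply aux_negD (hF.differentiableAt (isOpen_ball.mem_nhds (hsub hy)))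
      have : ∀ᶠ w : ℝ in nhds y, (w : ℂ) ∈ ball c ((k + 1) * ρ + ρ) :=
        Complex.continuous_ofReal.continuousAt.eventually_mem (isOpen_ball.mem_nhds (hsub hy))
      filter_upwards [this] with w hw using hf w hw

open Metric in
lemma aux_sinc : ∃ m : ℝ, 0 < m ∧ ∀ z ∈ ball (0 : ℂ) 2, m ≤ ‖dslope Complex.sin 0 z‖ := by
  have hc : Continuous (dslope Complex.sin 0) := by
    have : DifferentiableOn ℂ (dslope Complex.sin 0) Set.univ :=
      (Complex.differentiableOn_dslope Filter.univ_mem).2 Complex.differentiable_sin.differentiableOn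
    exact (differentiableOn_univ.1 this).continuous
  obtain ⟨z₀, hz₀, hmin⟩ := (isCompact_closedBall (0 : ℂ) 2).exists_isMinOn
    ⟨0, mem_closedBall_self (by norm_num)⟩ hc.norm.continuousOn
  refine ⟨‖dslope Complex.sin 0 z₀‖, ?_, fun z hz => hmin (ball_subset_closedBall hz)⟩
  rw [norm_pos_iff]
  by_cases h0 : z₀ = 0
  · rw [h0, dslope_same]; simp
  · rw [dslope_of_ne _ h0, slope_def_field]
    simp only [Complex.sin_zero, sub_zero]
    refine div_ne_zero ?_ h0
    intro hs
    obtain ⟨k, hk⟩ := Complex.sin_eq_zero_iff.1 hs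
    have hk0 : k ≠ 0 := by rintro rfl; simp at hk; exact h0 hk
    rw [mem_closedBall, dist_zero_right, hk, norm_mul, Complex.norm_real, Real.norm_eq_abs,
      abs_of_pos Real.pi_pos, Complex.norm_intCast] at hz₀
    have : (1 : ℝ) ≤ |(k : ℝ)| := by exact_mod_cast Int.one_le_abs hk0
    nlinarith [Real.pi_gt_three]

open Metric in
lemma aux_iter1 {ρ m : ℝ} (hρ : 0 < ρ) (hm : 0 < m)
    (hs : ∀ z ∈ ball (0 : ℂ) 2, m ≤ ‖dslope Complex.sin 0 z‖) (k : ℕ) :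
    ∀ (f : ℝ → ℝ) (F : ℂ → ℂ) (B : ℝ), 1 + k * ρ ≤ 2 → (∀ z, F (-z) = F z) →
    DifferentiableOn ℂ F (ball 0 (1 + k * ρ)) → (∀ z ∈ ball 0 (1 + k * ρ), ‖F z‖ ≤ B) →
    (∀ x : ℝ, 0 < x → x < 1 + k * ρ → f x = (F x).re) →
    ∀ x : ℝ, 0 < x → x < 1 → |(negD^[k] f) x| ≤ B / (ρ * m) ^ k := by
  induction k with
  | zero =>
    intro f F B _ _ _ hB hf x hx hx1
    simp only [Nat.cast_zero, zero_mul, add_zero] at *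
    simp only [Function.iterate_zero, id_eq, pow_zero, div_one]
    rw [hf x hx hx1]
    refine (Complex.abs_re_le_norm _).trans (hB _ ?_)
    simp [abs_of_pos hx, hx1]
  | succ k ih =>
    intro f F B h2 hev hF hB hf x hx hx1
    have he : (1 + (k + 1 : ℕ) * ρ : ℝ) = (1 + k * ρ) + ρ := by push_cast; ring
    rw [he] at h2 hF hB hf
    have hr : (0 : ℝ) < 1 + k * ρ := by positivity
    have hr1 : (1 : ℝ) ≤ 1 + k * ρ := by nlinarith [mul_nonneg (Nat.cast_nonneg (α := ℝ) k) hρ.le]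
    have hsub : ball (0 : ℂ) (1 + k * ρ) ⊆ ball 0 ((1 + k * ρ) + ρ) :=
      ball_subset_ball (by linarith)
    have hsub2 : ball (0 : ℂ) (1 + k * ρ) ⊆ ball 0 2 :=
      ball_subset_ball (by linarith)
    have hodd : ∀ z, deriv F (-z) = - deriv F z := by
      intro z
      have h := deriv_comp_neg F z
      simp only [hev] at h
      rw [h, neg_neg]
    have hd0 : deriv F 0 = 0 := by
      have := hodd 0
      rw [neg_zero] at this
      exact self_eq_neg.1 this
    have hval : ∀ z : ℂ, z ≠ 0 → dslope (deriv F) 0 z / dslope Complex.sin 0 z =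
        deriv F z / Complex.sin z := by
      intro z hz
      rw [dslope_of_ne _ hz, dslope_of_ne _ hz, slope_def_field, slope_def_field]
      simp only [Complex.sin_zero, sub_zero, hd0]
      rw [div_div_div_cancel_right₀ hz]
    have hsd : ∀ z ∈ ball (0 : ℂ) (1 + k * ρ), dslope Complex.sin 0 z ≠ 0 := by
      intro z hz h0
      have := hs z (hsub2 hz)
      rw [h0, norm_zero] at this
      linarith
    have hdF : DifferentiableOn ℂ (deriv F) (ball 0 (1 + k * ρ)) :=
      (hF.deriv isOpen_ball).mono hsub
    have hnhds : ball (0 : ℂ) (1 + k * ρ) ∈ nhds 0 := ball_mem_nhds _ hr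
    rw [Function.iterate_succ_apply]
    have := ih (negD f) (fun z => -(dslope (deriv F) 0 z / dslope Complex.sin 0 z)) (B / (ρ * m))
      (by linarith) ?_ ?_ ?_ ?_ x hx hx1
    · rw [pow_succ', ← div_div]; exact this
    · intro z
      by_cases hz : z = 0
      · simp [hz]
      · simp only [hval z hz, hval (-z) (neg_ne_zero.2 hz), hodd, Complex.sin_neg, neg_div_neg_eq]
    · apply DifferentiableOn.neg
      exact DifferentiableOn.div ((Complex.differentiableOn_dslope hnhds).2 hdF)
        ((Complex.differentiableOn_dslope hnhds).2 Complex.differentiable_sin.differentiableOn) hsd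
    · intro z hz
      have hB0 : 0 ≤ B := (norm_nonneg _).trans (hB _ (hsub hz))
      have h1 : ‖dslope (deriv F) 0 z‖ ≤ B / ρ := by
        have := Complex.norm_dslope_le_div_of_mapsTo_ball (R₂ := B / ρ) hdF (fun w hw => by
          rw [mem_closedBall, hd0, dist_zero_right]
          exact aux_cauchy hρ hF hB hw) hz
        exact this.trans (div_le_self (by positivity) hr1)
      rw [norm_neg, norm_div, ← div_div]
      exact div_le_div₀ ((norm_nonneg _).trans h1) h1 hm (hs z (hsub2 hz))
    · intro y hy hy1
      have hyb : (y : ℂ) ∈ ball (0 : ℂ) (1 + k * ρ) := by simpa [abs_of_pos hy] using hy1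
      simp only [hval (y : ℂ) (by exact_mod_cast hy.ne')]
      apply aux_negD (hF.differentiableAt (isOpen_ball.mem_nhds (hsub hyb)))
      filter_upwards [Ioo_mem_nhds hy (by linarith : y < 1 + k * ρ + ρ)] with w hw
        using hf w hw.1 hw.2

/-- complex extension of the n-th summand -/
noncomputable def auxF (t a : ℝ) (z : ℂ) : ℂ :=
  ((1 / Real.sqrt (4 * Real.pi * t) : ℝ) : ℂ) *
    (Complex.exp (-(z - a) ^ 2 / ((4 * t : ℝ) : ℂ)) + Complex.exp (-(z + a) ^ 2 / ((4 * t : ℝ) : ℂ)))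

lemma auxF_even (t a : ℝ) (z : ℂ) : auxF t a (-z) = auxF t a z := by
  unfold auxF
  have h1 : (-z - (a : ℂ)) ^ 2 = (z + a) ^ 2 := by ring
  have h2 : (-z + (a : ℂ)) ^ 2 = (z - a) ^ 2 := by ring
  rw [h1, h2, add_comm]

lemma auxF_diff (t a : ℝ) : Differentiable ℂ (auxF t a) := by
  unfold auxF
  simp only [div_eq_mul_inv]
  fun_prop

lemma auxF_re (t a x : ℝ) : W t (x - a) + W t (x + a) = (auxF t a x).re := by
  have : auxF t a x = ((W t (x - a) + W t (x + a) : ℝ) : ℂ) := by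
    unfold auxF W
    push_cast
    ring
  rw [this, Complex.ofReal_re]

lemma auxF_bound {t a E : ℝ} {z : ℂ} (ht : 0 < t)
    (h1 : E ≤ ((z - a) ^ 2).re) (h2 : E ≤ ((z + a) ^ 2).re) :
    ‖auxF t a z‖ ≤ (1 / Real.sqrt (4 * Real.pi * t)) * (2 * Real.exp (-E / (4 * t))) := by
  unfold auxF
  rw [norm_mul, Complex.norm_real, Real.norm_of_nonneg (by positivity)]
  apply mul_le_mul_of_nonneg_left _ (by positivity)
  refine (norm_add_le _ _).trans ?_
  rw [Complex.norm_exp, Complex.norm_exp, Complex.div_ofReal_re, Complex.div_ofReal_re,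
    Complex.neg_re, Complex.neg_re, two_mul]
  gcongr

open Metric in
lemma aux_small (N : ℕ) (hN : 1 ≤ N) : ∃ K : ℝ, 0 < K ∧ ∀ (φ t : ℝ) (n : ℕ), 0 < φ → φ < 1 →
    0 < t → t ≤ 1 →
    |(negD^[N] (fun x => W t (x - 2 * Real.pi * ((n : ℝ) + 1)) +
                  W t (x + 2 * Real.pi * ((n : ℝ) + 1)))) φ| ≤
      K * W t φ * Real.exp (-Real.pi ^ 2 / (4 * t)) * Real.exp (-1) ^ n := by
  obtain ⟨m, hm, hs⟩ := aux_sinc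
  have hN0 : (0 : ℝ) < N := by exact_mod_cast hN
  set ρ : ℝ := 1 / (2 * N) with hρd
  have hρ : 0 < ρ := by positivity
  have hNρ : N * ρ = 1 / 2 := by rw [hρd]; field_simp
  refine ⟨2 / (ρ * m) ^ N, by positivity, ?_⟩
  intro φ t n hφ hφ1 ht ht1
  set a : ℝ := 2 * Real.pi * ((n : ℝ) + 1) with ha
  have hn : (0 : ℝ) ≤ n := Nat.cast_nonneg n
  have hpi := Real.pi_gt_d2
  have hpi' := Real.pi_lt_d2
  have hkey : Real.pi ^ 2 + φ ^ 2 + 4 * n ≤ a ^ 2 - 3 * a - 9 / 4 := by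
    have h1 : 6.28 + 6 * n ≤ a := by rw [ha]; nlinarith
    nlinarith
  have hsq : ∀ z ∈ ball (0 : ℂ) (1 + N * ρ), a ^ 2 - 3 * a - 9 / 4 ≤ ((z - a) ^ 2).re ∧
      a ^ 2 - 3 * a - 9 / 4 ≤ ((z + a) ^ 2).re := by
    intro z hz
    rw [mem_ball, dist_zero_right, hNρ] at hz
    have hx := abs_le.1 ((Complex.abs_re_le_norm z).trans hz.le)
    have hzz : z.re ^ 2 + z.im ^ 2 ≤ 9 / 4 := by
      have := Complex.sq_norm z
      rw [Complex.normSq_apply] at this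
      nlinarith [norm_nonneg z]
    have ha0 : 0 ≤ a := by positivity
    simp only [sq, Complex.mul_re, Complex.sub_re, Complex.sub_im, Complex.add_re, Complex.add_im,
      Complex.ofReal_re, Complex.ofReal_im]
    constructor <;> nlinarith [sq_nonneg z.re]
  have hmain := aux_iter1 hρ hm hs N (fun x => W t (x - a) + W t (x + a)) (auxF t a)
    ((1 / Real.sqrt (4 * Real.pi * t)) * (2 * Real.exp (-(a ^ 2 - 3 * a - 9 / 4) / (4 * t))))
    (by rw [hNρ]; norm_num) (auxF_even t a) (auxF_diff t a).differentiableOn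
    (fun z hz => auxF_bound ht (hsq z hz).1 (hsq z hz).2) (fun x _ _ => auxF_re t a x) φ hφ hφ1
  refine hmain.trans ?_
  have hexp : Real.exp (-(a ^ 2 - 3 * a - 9 / 4) / (4 * t)) ≤
      Real.exp (-φ ^ 2 / (4 * t)) * Real.exp (-Real.pi ^ 2 / (4 * t)) * Real.exp (-1) ^ n := by
    rw [← Real.exp_nat_mul, ← Real.exp_add, ← Real.exp_add, Real.exp_le_exp]
    have h3 : -(n : ℝ) = -(4 * t * n) / (4 * t) := by field_simp
    rw [mul_neg_one, h3, ← add_div, ← add_div]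
    gcongr
    nlinarith
  unfold W
  calc _ ≤ 1 / Real.sqrt (4 * Real.pi * t) * (2 * (Real.exp (-φ ^ 2 / (4 * t)) *
        Real.exp (-Real.pi ^ 2 / (4 * t)) * Real.exp (-1) ^ n)) / (ρ * m) ^ N := by gcongr
    _ = _ := by ring

lemma aux_norm_sin (z : ℂ) : |Real.sin z.re| ≤ ‖Complex.sin z‖ := by
  refine le_trans ?_ (Complex.abs_re_le_norm _)
  have : (Complex.sin z).re = Real.sin z.re * Real.cosh z.im := by
    conv_lhs => rw [← Complex.re_add_im z, Complex.sin_add_mul_I]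
    simp [← Complex.ofReal_sin, ← Complex.ofReal_cos, ← Complex.ofReal_cosh, ← Complex.ofReal_sinh]
  rw [this, abs_mul]
  exact le_mul_of_one_le_right (abs_nonneg _) ((Real.one_le_cosh _).trans (le_abs_self _))

lemma aux_sin_lower {s x : ℝ} (hs : 0 < s) (hs' : s ≤ Real.pi) (hx : 1 / 2 ≤ x)
    (hx' : s / 2 ≤ Real.pi - x) : s / 16 ≤ Real.sin x := by
  have hpi := Real.pi_gt_d2
  have hpi' := Real.pi_lt_d2
  have h2 : (1 : ℝ) / 2 ≤ 2 / Real.pi := by rw [div_le_div_iff₀] <;> linarith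
  rcases le_total x (Real.pi / 2) with h | h
  · have := Real.mul_le_sin (by linarith : 0 ≤ x) h
    nlinarith
  · have := Real.mul_le_sin (by linarith : 0 ≤ Real.pi - x) (by linarith)
    rw [Real.sin_pi_sub] at this
    nlinarith

open Metric in
lemma aux_large (N : ℕ) : ∃ K : ℝ, 0 < K ∧ ∀ (φ t : ℝ) (n : ℕ), 1 ≤ φ → φ < Real.pi →
    0 < t → t ≤ 1 → t ≤ Real.pi - φ →
    |(negD^[N] (fun x => W t (x - 2 * Real.pi * ((n : ℝ) + 1)) +
                  W t (x + 2 * Real.pi * ((n : ℝ) + 1)))) φ| ≤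
      K * W t φ * (((Real.pi - φ) ^ N)⁻¹ * (t ^ N)⁻¹) *
        Real.exp (-Real.pi * (Real.pi - φ) / t) * Real.exp (-1) ^ n := by
  refine ⟨2 * Real.exp 3 * (32 * (N + 1)) ^ N, by positivity, ?_⟩
  intro φ t n hφ hφ1 ht ht1 hts
  obtain ⟨s, hsd⟩ : ∃ s, s = Real.pi - φ := ⟨_, rfl⟩
  rw [← hsd] at hts ⊢
  have hs : 0 < s := by linarith
  set a : ℝ := 2 * Real.pi * ((n : ℝ) + 1) with ha
  have hn : (0 : ℝ) ≤ n := Nat.cast_nonneg n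
  have hpi := Real.pi_gt_d2
  have hpi' := Real.pi_lt_d2
  have ha0 : 0 ≤ a := by positivity
  set ρ : ℝ := t / (2 * (N + 1)) with hρd
  have hρ : 0 < ρ := by positivity
  have hNρ : (N + 1) * ρ = t / 2 := by rw [hρd]; field_simp
  have hsin : ∀ z ∈ ball (φ : ℂ) ((N + 1) * ρ), s / 16 ≤ ‖Complex.sin z‖ := by
    intro z hz
    rw [mem_ball, Complex.dist_eq, hNρ] at hz
    have hx := abs_le.1 ((Complex.abs_re_le_norm _).trans hz.le)
    simp only [Complex.sub_re, Complex.ofReal_re] at hx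
    refine le_trans ?_ (aux_norm_sin z)
    refine le_trans ?_ (le_abs_self _)
    apply aux_sin_lower hs <;> linarith
  have hsq : ∀ z ∈ ball (φ : ℂ) ((N + 1) * ρ),
      (a - φ) ^ 2 - (a + Real.pi) * t - t / 4 ≤ ((z - a) ^ 2).re ∧
      (a - φ) ^ 2 - (a + Real.pi) * t - t / 4 ≤ ((z + a) ^ 2).re := by
    intro z hz
    rw [mem_ball, Complex.dist_eq, hNρ] at hz
    have hx := abs_le.1 ((Complex.abs_re_le_norm _).trans hz.le)
    have hy := abs_le.1 ((Complex.abs_im_le_norm _).trans hz.le)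
    simp only [Complex.sub_re, Complex.ofReal_re, Complex.sub_im, Complex.ofReal_im, sub_zero]
      at hx hy
    simp only [sq, Complex.mul_re, Complex.sub_re, Complex.sub_im, Complex.add_re, Complex.add_im,
      Complex.ofReal_re, Complex.ofReal_im, sub_zero, add_zero]
    obtain ⟨u, hu⟩ : ∃ u, u = z.re - φ := ⟨_, rfl⟩
    have hzu : z.re = φ + u := by linarith
    rw [← hu] at hx
    rw [hzu]
    have hyy : z.im * z.im ≤ t / 4 := by nlinarith
    have haφ : φ ≤ a := by rw [ha]; nlinarith
    have hφa : 0 ≤ φ * a := by positivity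
    constructor
    · nlinarith [sq_nonneg u, mul_nonneg (sub_nonneg.2 haφ) (by linarith : 0 ≤ t / 2 - u),
        mul_nonneg (by linarith : 0 ≤ φ) ht.le]
    · nlinarith [sq_nonneg u, mul_nonneg (by linarith : 0 ≤ a + φ) (by linarith : 0 ≤ t / 2 + u),
        mul_nonneg (by linarith : 0 ≤ Real.pi - φ) ht.le]
  have hmain := aux_iter2 hρ (by positivity : 0 < s / 16) N (fun x => W t (x - a) + W t (x + a))
    (auxF t a)
    ((1 / Real.sqrt (4 * Real.pi * t)) *
      (2 * Real.exp (-((a - φ) ^ 2 - (a + Real.pi) * t - t / 4) / (4 * t))))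
    hsin (auxF_diff t a).differentiableOn
    (fun z hz => auxF_bound ht (hsq z hz).1 (hsq z hz).2) (fun x _ => auxF_re t a x) φ
    (mem_ball_self hρ)
  refine hmain.trans ?_
  have hexp : Real.exp (-((a - φ) ^ 2 - (a + Real.pi) * t - t / 4) / (4 * t)) ≤
      Real.exp 3 * Real.exp (-φ ^ 2 / (4 * t)) * Real.exp (-Real.pi * s / t) *
        Real.exp (-1) ^ n := by
    rw [← Real.exp_nat_mul, ← Real.exp_add, ← Real.exp_add, ← Real.exp_add, Real.exp_le_exp]
    have h3 : 3 + -φ ^ 2 / (4 * t) + -Real.pi * s / t + n * (-1) =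
      (12 * t - φ ^ 2 - 4 * Real.pi * s - 4 * t * n) / (4 * t) := by field_simp; ring
    rw [h3]
    gcongr
    have h4 : (a - φ) ^ 2 = φ ^ 2 + 4 * Real.pi * (s + n * s + Real.pi * (n * (n + 1))) := by
      rw [ha, hsd]; ring
    rw [h4]
    have h5 : (n : ℝ) * t ≤ n := by nlinarith
    have h6 : 0 ≤ Real.pi * (n * s) := by positivity
    have h7 : 9 * (n : ℝ) ≤ Real.pi * (Real.pi * (n * (n + 1))) := by
      have : 9 ≤ Real.pi * Real.pi := by nlinarith
      have h8 : (n : ℝ) ≤ n * (n + 1) := by nlinarith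
      nlinarith
    have h9 : (a + Real.pi) * t ≤ 9.45 * t + 6.3 * n := by
      rw [ha]
      have : Real.pi * (n * t) ≤ 3.15 * n := by
        have : 0 ≤ n * t := by positivity
        nlinarith
      nlinarith
    nlinarith
  have hpow : (ρ * (s / 16)) ^ N * (32 * (N + 1)) ^ N = s ^ N * t ^ N := by
    rw [← mul_pow, ← mul_pow, hρd]
    congr 1
    field_simp
    ring
  have hpow' : ((ρ * (s / 16)) ^ N)⁻¹ = (32 * (N + 1)) ^ N * ((s ^ N)⁻¹ * (t ^ N)⁻¹) := by
    rw [← mul_inv, ← hpow]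
    have : ρ * (s / 16) ≠ 0 := by positivity
    field_simp
  rw [div_eq_mul_inv, hpow']
  unfold W
  calc _ ≤ 1 / Real.sqrt (4 * Real.pi * t) * (2 * (Real.exp 3 * Real.exp (-φ ^ 2 / (4 * t)) *
        Real.exp (-Real.pi * s / t) * Real.exp (-1) ^ n)) *
        ((32 * (N + 1)) ^ N * ((s ^ N)⁻¹ * (t ^ N)⁻¹)) := by gcongr
    _ = _ := by ring

/-- Estimate (4.1) of the paper: the tail of the periodization is negligible in the regime
`(π-φ)/t ≥ M₁`. -/
theorem negD_iter_theta_tail_bound (N : ℕ) (hN : 1 ≤ N) :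
    ∃ M₁ : ℝ, 1 ≤ M₁ ∧ ∃ C : ℝ, 0 < C ∧
      ∀ φ t : ℝ, φ ∈ Set.Ioo 0 Real.pi → 0 < t → t ≤ 1 → M₁ ≤ (Real.pi - φ) / t →
        ∑' n : ℕ,
            |(negD^[N] (fun x =>
                W t (x - 2 * Real.pi * ((n : ℝ) + 1)) +
                  W t (x + 2 * Real.pi * ((n : ℝ) + 1)))) φ| ≤
          C * W t φ * (Real.pi - φ) ^ (-(N : ℝ)) * t ^ (-(N : ℝ)) *
            (Real.exp (-Real.pi ^ 2 / (4 * t)) + Real.exp (-Real.pi * (Real.pi - φ) / t)) := by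
  obtain ⟨K₁, hK₁, h₁⟩ := aux_small N hN
  obtain ⟨K₂, hK₂, h₂⟩ := aux_large N
  set K := K₁ * Real.pi ^ N + K₂ with hK
  have hpi := Real.pi_pos
  have he : Real.exp (-1) < 1 := by rw [Real.exp_lt_one_iff]; norm_num
  have hg := hasSum_geometric_of_lt_one (Real.exp_pos (-1)).le he
  refine ⟨1, le_rfl, K * (1 - Real.exp (-1))⁻¹, ?_, ?_⟩
  · have : 0 < 1 - Real.exp (-1) := by linarith
    positivity
  intro φ t hφ ht ht1 hM
  have hs : 0 < Real.pi - φ := by linarith [hφ.2]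
  have hts : t ≤ Real.pi - φ := by rwa [one_le_div ht] at hM
  have hW : 0 < W t φ := by unfold W; positivity
  rw [Real.rpow_neg hs.le, Real.rpow_neg ht.le, Real.rpow_natCast, Real.rpow_natCast]
  set E₁ := Real.exp (-Real.pi ^ 2 / (4 * t)) with hE₁
  set E₂ := Real.exp (-Real.pi * (Real.pi - φ) / t) with hE₂
  have hE₁0 : 0 < E₁ := Real.exp_pos _
  have hE₂0 : 0 < E₂ := Real.exp_pos _
  set S := ((Real.pi - φ) ^ N)⁻¹ with hS
  set T := (t ^ N)⁻¹ with hT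
  have hS0 : 0 < S := by positivity
  have hT0 : 0 < T := by positivity
  have hterm : ∀ n : ℕ, |(negD^[N] (fun x => W t (x - 2 * Real.pi * ((n : ℝ) + 1)) +
                  W t (x + 2 * Real.pi * ((n : ℝ) + 1)))) φ| ≤
      (K * W t φ * S * T * (E₁ + E₂)) * Real.exp (-1) ^ n := by
    intro n
    rcases lt_or_ge φ 1 with h | h
    · refine (h₁ φ t n hφ.1 h ht ht1).trans ?_
      refine mul_le_mul_of_nonneg_right ?_ (by positivity)
      have h1 : 1 ≤ Real.pi ^ N * S * T := by
        have hT1 : 1 ≤ T := (one_le_inv₀ (by positivity)).2 (pow_le_one₀ ht.le ht1)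
        have hS1 : 1 ≤ Real.pi ^ N * S := by
          rw [hS, ← div_eq_mul_inv, one_le_div (by positivity)]
          exact pow_le_pow_left₀ hs.le (by linarith [hφ.1]) N
        nlinarith
      calc K₁ * W t φ * E₁ ≤ K₁ * W t φ * E₁ * (Real.pi ^ N * S * T) :=
            le_mul_of_one_le_right (by positivity) h1
        _ = K₁ * Real.pi ^ N * W t φ * S * T * E₁ := by ring
        _ ≤ K * W t φ * S * T * (E₁ + E₂) := by
            gcongr <;> linarith
    · refine (h₂ φ t n h hφ.2 ht ht1 hts).trans ?_
      refine mul_le_mul_of_nonneg_right ?_ (by positivity)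
      have hK0 : 0 < K₁ * Real.pi ^ N := by positivity
      calc K₂ * W t φ * (S * T) * E₂ = K₂ * W t φ * S * T * E₂ := by ring
        _ ≤ K * W t φ * S * T * (E₁ + E₂) := by
            gcongr <;> linarith
  have hsum := hg.mul_left (K * W t φ * S * T * (E₁ + E₂))
  have hsm := Summable.of_nonneg_of_le (fun n => abs_nonneg _) hterm hsum.summable
  refine (hsm.tsum_le_tsum hterm hsum.summable).trans ?_
  rw [hsum.tsum_eq]
  apply le_of_eq
  ring
end

section
/- Let N ≥ 1 be a fixed integer. For any M₀ > 0 there exist t₁ > 0 and a constant C > 0 such that for all φ ∈ [π/2,π) and 0 < t ≤ t₁ satisfying (π−φ)/t ≤ M₀: Σ_{n=1}^{∞} |(−D)^N[φ ↦ W_t(φ+2πn) + W_t(φ−2π(n+1))](φ)| ≤ C·W_t(φ)·t^{-2N}·e^{-π²/(4t)}. -/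
/-- One step: divide the derivative of an even holomorphic function by `sin`. -/
lemma step_exists (r ρ : ℝ) (hρ : 0 < ρ) (hρr : ρ < r) (hr : r < Real.pi) :
    ∃ C : ℝ, 0 < C ∧ ∀ (g : ℂ → ℂ) (B : ℝ), DifferentiableOn ℂ g (Metric.ball 0 r) →
      (∀ z, g (-z) = g z) → (∀ z ∈ Metric.ball (0 : ℂ) r, ‖g z‖ ≤ B) →
      ∃ h : ℂ → ℂ, DifferentiableOn ℂ h (Metric.ball 0 ρ) ∧ (∀ z, h (-z) = h z) ∧
        (∀ z ∈ Metric.ball (0 : ℂ) ρ, ‖h z‖ ≤ C * B) ∧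
        (∀ z ∈ Metric.ball (0 : ℂ) ρ, deriv g z = h z * Complex.sin z) := by
  have hsin : ∀ z ∈ Metric.ball (0 : ℂ) r, z ≠ 0 → Complex.sin z ≠ 0 := by
    intro z hz hz0 hs
    obtain ⟨k, hk⟩ := Complex.sin_eq_zero_iff.1 hs
    have hk0 : k ≠ 0 := by
      rintro rfl
      simp at hk
      exact hz0 hk
    have h1 : (1 : ℝ) ≤ |(k : ℝ)| := by
      exact_mod_cast Int.one_le_abs hk0
    have h2 : ‖z‖ = |(k : ℝ)| * Real.pi := by
      rw [hk]
      simp [abs_of_pos Real.pi_pos]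
    have h3 : ‖z‖ < r := by simpa using hz
    nlinarith [Real.pi_pos]
  have hsph : ∀ z ∈ Metric.sphere (0 : ℂ) ρ, z ∈ Metric.ball (0 : ℂ) r ∧ z ≠ 0 := by
    intro z hz
    have h1 : ‖z‖ = ρ := by simpa using hz
    refine ⟨by simpa [h1] using hρr, ?_⟩
    rintro rfl
    simp at h1
    linarith
  obtain ⟨m, hm, hmb⟩ : ∃ m : ℝ, 0 < m ∧ ∀ z ∈ Metric.sphere (0 : ℂ) ρ, m ≤ ‖Complex.sin z‖ := by
    have hne : (Metric.sphere (0 : ℂ) ρ).Nonempty := ⟨(ρ : ℂ), by simp [abs_of_pos hρ]⟩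
    obtain ⟨z0, hz0, hmin⟩ := (isCompact_sphere (0 : ℂ) ρ).exists_isMinOn hne
      (f := fun z => ‖Complex.sin z‖) (by fun_prop)
    exact ⟨_, norm_pos_iff.2 (hsin z0 (hsph z0 hz0).1 (hsph z0 hz0).2), fun z hz => hmin hz⟩
  have hδ : 0 < (r - ρ) / 2 := by linarith
  refine ⟨1 / ((r - ρ) / 2) / m, by positivity, ?_⟩
  intro g B hg heven hB
  have hopen : IsOpen (Metric.ball (0 : ℂ) r) := Metric.isOpen_ball
  have h0r : (0 : ℂ) ∈ Metric.ball (0 : ℂ) r := by simp; linarith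
  have hg' : DifferentiableOn ℂ (deriv g) (Metric.ball 0 r) := hg.deriv hopen
  have hodd : ∀ z, deriv g (-z) = - deriv g z := by
    intro z
    have h1 : deriv (fun w => g (-w)) z = - deriv g (-z) := deriv_comp_neg g z
    have h2 : (fun w => g (-w)) = g := funext heven
    rw [h2] at h1
    rw [h1, neg_neg]
  have hz' : deriv g 0 = 0 := by
    have := hodd 0
    rw [neg_zero] at this
    exact self_eq_neg.1 this
  have hnhds : Metric.ball (0 : ℂ) r ∈ nhds (0 : ℂ) := hopen.mem_nhds h0r
  have hd1 : DifferentiableOn ℂ (dslope (deriv g) 0) (Metric.ball 0 r) :=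
    (Complex.differentiableOn_dslope hnhds).2 hg'
  have hd2 : DifferentiableOn ℂ (dslope Complex.sin 0) (Metric.ball 0 r) :=
    (Complex.differentiableOn_dslope hnhds).2 Complex.differentiable_sin.differentiableOn
  have hs1 : ∀ z, z ≠ 0 → dslope (deriv g) 0 z = deriv g z / z := by
    intro z hz
    rw [dslope_of_ne _ hz, slope_def_field, hz']
    simp
  have hs2 : ∀ z, z ≠ 0 → dslope Complex.sin 0 z = Complex.sin z / z := by
    intro z hz
    rw [dslope_of_ne _ hz, slope_def_field]
    simp
  have hs20 : dslope Complex.sin 0 0 = 1 := by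
    rw [dslope_same]; simp
  have hne2 : ∀ z ∈ Metric.ball (0 : ℂ) r, dslope Complex.sin 0 z ≠ 0 := by
    intro z hz
    by_cases h : z = 0
    · rw [h, hs20]; exact one_ne_zero
    · rw [hs2 z h]; exact div_ne_zero (hsin z hz h) h
  set h : ℂ → ℂ := fun z => dslope (deriv g) 0 z / dslope Complex.sin 0 z with hh
  have hdh : DifferentiableOn ℂ h (Metric.ball 0 r) := hd1.div hd2 hne2
  have hval : ∀ z, z ≠ 0 → h z = deriv g z / Complex.sin z := by
    intro z hz
    simp only [hh]
    rw [hs1 z hz, hs2 z hz, div_div_div_cancel_right₀ hz]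
  have hsub : Metric.closedBall (0 : ℂ) ρ ⊆ Metric.ball 0 r :=
    Metric.closedBall_subset_ball hρr
  refine ⟨h, hdh.mono (Metric.ball_subset_closedBall.trans hsub), ?_, ?_, ?_⟩
  · intro z
    by_cases hz : z = 0
    · simp [hz]
    · rw [hval z hz, hval (-z) (neg_ne_zero.2 hz), hodd, Complex.sin_neg, neg_div_neg_eq]
  · have hcl : closure (Metric.ball (0 : ℂ) ρ) = Metric.closedBall 0 ρ :=
      closure_ball _ hρ.ne'
    have hdc : DiffContOnCl ℂ h (Metric.ball 0 ρ) :=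
      ⟨hdh.mono (Metric.ball_subset_closedBall.trans hsub), by
        rw [hcl]; exact hdh.continuousOn.mono hsub⟩
    intro z hz
    refine Complex.norm_le_of_forall_mem_frontier_norm_le Metric.isBounded_ball hdc ?_
      (subset_closure hz)
    intro w hw
    rw [frontier_ball _ hρ.ne'] at hw
    obtain ⟨hwr, hw0⟩ := hsph w hw
    have hnw : ‖w‖ = ρ := by simpa using hw
    have hballw : Metric.closedBall w ((r - ρ) / 2) ⊆ Metric.ball 0 r := by
      intro v hv
      rw [Metric.mem_closedBall, dist_eq_norm] at hv
      rw [Metric.mem_ball, dist_zero_right]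
      have : ‖v‖ ≤ ‖v - w‖ + ‖w‖ := by simpa using norm_add_le (v - w) w
      linarith
    have hcauchy : ‖deriv g w‖ ≤ B / ((r - ρ) / 2) := by
      refine Complex.norm_deriv_le_of_forall_mem_sphere_norm_le hδ ?_ ?_
      · refine DifferentiableOn.diffContOnCl ?_
        rw [closure_ball _ hδ.ne']
        exact hg.mono hballw
      · intro v hv
        exact hB v (hballw (Metric.sphere_subset_closedBall hv))
    have hB0 : 0 ≤ B := (norm_nonneg _).trans (hB 0 h0r)
    rw [hval w hw0, norm_div]
    calc ‖deriv g w‖ / ‖Complex.sin w‖ ≤ (B / ((r - ρ) / 2)) / m := by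
          gcongr
          exact hmb w hw
      _ = _ := by ring
  · intro z hz
    by_cases hz0 : z = 0
    · simp [hz0, hz']
    · rw [hval z hz0, div_mul_cancel₀]
      exact hsin z (hsub (Metric.ball_subset_closedBall hz)) hz0

lemma iter_bound (N : ℕ) : ∀ r₀ r₁ : ℝ, 0 < r₁ → r₁ < r₀ → r₀ < Real.pi →
    ∃ C : ℝ, 0 < C ∧ ∀ (g : ℂ → ℂ) (B : ℝ), DifferentiableOn ℂ g (Metric.ball 0 r₀) →
      (∀ z, g (-z) = g z) → (∀ z ∈ Metric.ball (0 : ℂ) r₀, ‖g z‖ ≤ B) →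
      ∀ F : ℝ → ℝ, (∀ x ∈ Set.Ioo (Real.pi - r₀) Real.pi, F x = (g ((Real.pi - x : ℝ) : ℂ)).re) →
      ∀ x ∈ Set.Ioo (Real.pi - r₁) Real.pi, |negD^[N] F x| ≤ C * B := by
  induction N with
  | zero =>
    intro r₀ r₁ h1 h2 h3
    refine ⟨1, one_pos, ?_⟩
    intro g B _ _ hB F hF x hx
    rw [Function.iterate_zero_apply, hF x ⟨by linarith [hx.1], hx.2⟩, one_mul]
    refine (Complex.abs_re_le_norm _).trans (hB _ ?_)
    rw [Metric.mem_ball, dist_zero_right, Complex.norm_real, Real.norm_eq_abs, abs_lt]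
    constructor <;> linarith [hx.1, hx.2]
  | succ N ih =>
    intro r₀ r₁ h1 h2 h3
    obtain ⟨C1, hC1, H1⟩ := step_exists r₀ ((r₀ + r₁) / 2) (by linarith) (by linarith) h3
    obtain ⟨C2, hC2, H2⟩ := ih ((r₀ + r₁) / 2) r₁ h1 (by linarith) (by linarith)
    refine ⟨C2 * C1, by positivity, ?_⟩
    intro g B hg heven hB F hF x hx
    obtain ⟨h, hh1, hh2, hh3, hh4⟩ := H1 g B hg heven hB
    rw [Function.iterate_succ_apply, mul_assoc]
    refine H2 h (C1 * B) hh1 hh2 hh3 (negD F) ?_ x hx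
    intro y hy
    have hmem : ∀ ρ : ℝ, y ∈ Set.Ioo (Real.pi - ρ) Real.pi →
        ((Real.pi - y : ℝ) : ℂ) ∈ Metric.ball (0 : ℂ) ρ := by
      intro ρ hy
      rw [Metric.mem_ball, dist_zero_right, Complex.norm_real, Real.norm_eq_abs, abs_lt]
      constructor <;> linarith [hy.1, hy.2]
    have hy0 : y ∈ Set.Ioo (Real.pi - r₀) Real.pi := ⟨by linarith [hy.1], hy.2⟩
    have hd : HasDerivAt g (deriv g ((Real.pi - y : ℝ) : ℂ)) ((Real.pi - y : ℝ) : ℂ) :=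
      (hg.differentiableAt (Metric.isOpen_ball.mem_nhds (hmem r₀ hy0))).hasDerivAt
    have hd2 := hd.real_of_complex
    have hd3 : HasDerivAt (fun x : ℝ => (g ((Real.pi - x : ℝ) : ℂ)).re)
        ((deriv g ((Real.pi - y : ℝ) : ℂ)).re * (-1)) y :=
      HasDerivAt.comp y hd2 ((hasDerivAt_id y).const_sub Real.pi)
    have hd4 : deriv F y = (deriv g ((Real.pi - y : ℝ) : ℂ)).re * (-1) := by
      refine (hd3.congr_of_eventuallyEq ?_).deriv
      filter_upwards [isOpen_Ioo.mem_nhds hy0] with w hw using hF w hw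
    have hsinpos : 0 < Real.sin y := Real.sin_pos_of_pos_of_lt_pi (by linarith [hy.1]) hy.2
    unfold negD
    rw [hd4, hh4 _ (hmem _ hy), ← Complex.ofReal_sin, Complex.re_mul_ofReal, Real.sin_pi_sub]
    field_simp

lemma gauss_norm (t : ℝ) (ht : 0 < t) (n : ℕ) (a : ℝ) (ha : |a| = (2 * n + 3) * Real.pi) (z : ℂ)
    (hz : z ∈ Metric.ball (0 : ℂ) (2 * Real.pi / 3)) :
    ‖Complex.exp (-((a : ℂ) + z) ^ 2 / (4 * t))‖ ≤
      Real.exp (-(2 + n) * Real.pi ^ 2 / (4 * t)) := by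
  rw [Complex.norm_exp]
  have h1 : (-((a : ℂ) + z) ^ 2 / (4 * t)).re = -((a + z.re) ^ 2 - z.im ^ 2) / (4 * t) := by
    have : (4 * (t : ℂ)) = ((4 * t : ℝ) : ℂ) := by push_cast; ring
    rw [this, Complex.div_ofReal_re]
    congr 1
    simp [pow_two]
  rw [h1]
  apply Real.exp_le_exp.2
  apply div_le_div_of_nonneg_right _ (by positivity)
  have hz' : ‖z‖ < 2 * Real.pi / 3 := by simpa using hz
  have hre : |z.re| ≤ 2 * Real.pi / 3 := (Complex.abs_re_le_norm z).trans hz'.le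
  have him : |z.im| ≤ 2 * Real.pi / 3 := (Complex.abs_im_le_norm z).trans hz'.le
  have him2 : z.im ^ 2 ≤ (2 * Real.pi / 3) ^ 2 := sq_le_sq' (abs_le.1 him).1 (abs_le.1 him).2
  have h2 : (2 * n + 7 / 3) * Real.pi ≤ |a + z.re| := by
    have := abs_sub_abs_le_abs_sub a (-z.re)
    rw [abs_neg, sub_neg_eq_add] at this
    linarith
  have h3 : ((2 * n + 7 / 3) * Real.pi) ^ 2 ≤ (a + z.re) ^ 2 := by
    rw [← sq_abs (a + z.re)]
    have := Real.pi_pos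
    gcongr
  have hn : (0 : ℝ) ≤ n := n.cast_nonneg
  have h4 : (0 : ℝ) ≤ (n ^ 2 + n) * Real.pi ^ 2 := by positivity
  nlinarith [sq_nonneg Real.pi, mul_nonneg hn (sq_nonneg Real.pi)]

/-- Estimate (4.2) of the paper: the tail of the periodization is negligible in the regime
`(π-φ)/t ≤ M₀`, for `φ ∈ [π/2, π)`. -/
theorem negD_iter_theta_tail_bound_near_antipode (N : ℕ) (hN : 1 ≤ N) :
    ∀ M₀ : ℝ, 0 < M₀ → ∃ t₁ : ℝ, 0 < t₁ ∧ ∃ C : ℝ, 0 < C ∧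
      ∀ φ t : ℝ, φ ∈ Set.Ico (Real.pi / 2) Real.pi → 0 < t → t ≤ t₁ →
        (Real.pi - φ) / t ≤ M₀ →
        ∑' n : ℕ,
            |(negD^[N] (fun x =>
                W t (x + 2 * Real.pi * ((n : ℝ) + 1)) +
                  W t (x - 2 * Real.pi * ((n : ℝ) + 2)))) φ| ≤
          C * W t φ * t ^ (-(2 * (N : ℝ))) * Real.exp (-Real.pi ^ 2 / (4 * t)) := by
  intro M₀ _
  have hpi := Real.pi_pos
  obtain ⟨C, hC, H⟩ := iter_bound N (2 * Real.pi / 3) (7 * Real.pi / 12) (by linarith)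
    (by linarith) (by linarith)
  set q : ℝ := Real.exp (-Real.pi ^ 2 / 4) with hq
  have hq0 : 0 < q := Real.exp_pos _
  have hq1 : q < 1 := by
    rw [hq, Real.exp_lt_one_iff]
    have : 0 < Real.pi ^ 2 := by positivity
    linarith
  have hq1' : 0 < 1 - q := by linarith
  refine ⟨1, one_pos, 2 * C * (1 - q)⁻¹, by positivity, ?_⟩
  intro φ t hφ ht ht1 _
  set c : ℝ := 1 / Real.sqrt (4 * Real.pi * t) with hc
  have hc0 : 0 ≤ c := by positivity
  set E : ℝ := Real.exp (-Real.pi ^ 2 / (4 * t)) with hE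
  have hterm : ∀ n : ℕ, |(negD^[N] (fun x =>
                W t (x + 2 * Real.pi * ((n : ℝ) + 1)) +
                  W t (x - 2 * Real.pi * ((n : ℝ) + 2)))) φ| ≤ (2 * C * c * (E * E)) * q ^ n := by
    intro n
    have hn : (0 : ℝ) ≤ n := n.cast_nonneg
    set a : ℝ := (2 * n + 3) * Real.pi with ha
    have ha0 : 0 ≤ a := by positivity
    have key := H (fun z => (c : ℂ) * (Complex.exp (-(((-a : ℝ) : ℂ) + z) ^ 2 / (4 * t)) +
        Complex.exp (-((a : ℂ) + z) ^ 2 / (4 * t))))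
      (c * (2 * Real.exp (-(2 + n) * Real.pi ^ 2 / (4 * t)))) (by fun_prop) ?_ ?_
      (fun x => W t (x + 2 * Real.pi * ((n : ℝ) + 1)) +
                  W t (x - 2 * Real.pi * ((n : ℝ) + 2))) ?_ φ
      ⟨by linarith [hφ.1], hφ.2⟩
    · refine key.trans ?_
      have h1 : Real.exp (-(2 + n) * Real.pi ^ 2 / (4 * t)) ≤ E * E * q ^ n := by
        rw [hE, hq, ← Real.exp_nat_mul, ← Real.exp_add, ← Real.exp_add]
        apply Real.exp_le_exp.2
        have h2 : (n : ℝ) * Real.pi ^ 2 / 4 ≤ n * Real.pi ^ 2 / (4 * t) := by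
          apply div_le_div_of_nonneg_left (by positivity) (by positivity)
          linarith
        have h3 : -(2 + n) * Real.pi ^ 2 / (4 * t) = -Real.pi ^ 2 / (4 * t) +
          -Real.pi ^ 2 / (4 * t) - n * Real.pi ^ 2 / (4 * t) := by ring
        rw [h3]
        linarith
      calc C * (c * (2 * Real.exp (-(2 + n) * Real.pi ^ 2 / (4 * t))))
          ≤ C * (c * (2 * (E * E * q ^ n))) := by gcongr
        _ = _ := by ring
    · intro z
      have e1 : (((-a : ℝ) : ℂ) + -z) ^ 2 = ((a : ℂ) + z) ^ 2 := by push_cast; ring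
      have e2 : ((a : ℂ) + -z) ^ 2 = (((-a : ℝ) : ℂ) + z) ^ 2 := by push_cast; ring
      simp only [e1, e2]
      rw [add_comm]
    · intro z hz
      rw [norm_mul, Complex.norm_real, Real.norm_eq_abs, abs_of_nonneg hc0]
      refine mul_le_mul_of_nonneg_left ?_ hc0
      refine (norm_add_le _ _).trans ?_
      have g1 := gauss_norm t ht n (-a) (by rw [abs_neg, abs_of_nonneg ha0]) z hz
      have g2 := gauss_norm t ht n a (abs_of_nonneg ha0) z hz
      linarith
    · intro x _
      have e : (c : ℂ) * (Complex.exp (-(((-a : ℝ) : ℂ) + ((Real.pi - x : ℝ) : ℂ)) ^ 2 / (4 * t)) +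
          Complex.exp (-((a : ℂ) + ((Real.pi - x : ℝ) : ℂ)) ^ 2 / (4 * t))) =
          ((c * (Real.exp (-(-a + (Real.pi - x)) ^ 2 / (4 * t)) +
            Real.exp (-(a + (Real.pi - x)) ^ 2 / (4 * t))) : ℝ) : ℂ) := by
        push_cast; ring
      simp only [e, Complex.ofReal_re, W, ← hc]
      rw [← mul_add]
      have e1 : (-a + (Real.pi - x)) ^ 2 = (x + 2 * Real.pi * ((n : ℝ) + 1)) ^ 2 := by
        rw [ha]; ring
      have e2 : (a + (Real.pi - x)) ^ 2 = (x - 2 * Real.pi * ((n : ℝ) + 2)) ^ 2 := by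
        rw [ha]; ring
      rw [e1, e2]
  have hgeo : HasSum (fun n : ℕ => (2 * C * c * (E * E)) * q ^ n)
      ((2 * C * c * (E * E)) * (1 - q)⁻¹) :=
    (hasSum_geometric_of_lt_one hq0.le hq1).mul_left _
  have hsummable := Summable.of_nonneg_of_le (fun n => abs_nonneg _) hterm hgeo.summable
  refine (hsummable.tsum_le_tsum hterm hgeo.summable).trans ?_
  rw [hgeo.tsum_eq]
  have hE0 : 0 < E := Real.exp_pos _
  have hW : c * E ≤ W t φ := by
    unfold W
    rw [← hc, hE]
    refine mul_le_mul_of_nonneg_left (Real.exp_le_exp.2 ?_) hc0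
    apply div_le_div_of_nonneg_right _ (by positivity)
    have : φ ^ 2 ≤ Real.pi ^ 2 := by
      have h0 : 0 ≤ φ := by linarith [hφ.1]
      have h1 := hφ.2.le
      gcongr
    linarith
  have ht' : (1 : ℝ) ≤ t ^ (-(2 * (N : ℝ))) :=
    Real.one_le_rpow_of_pos_of_le_one_of_nonpos ht ht1 (by
      have : (0 : ℝ) ≤ N := N.cast_nonneg
      linarith)
  have hW0 : 0 ≤ W t φ := le_trans (by positivity) hW
  calc 2 * C * c * (E * E) * (1 - q)⁻¹ = 2 * C * (1 - q)⁻¹ * (c * E) * 1 * E := by ring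
    _ ≤ _ := by gcongr
end

section
/- Let N ≥ 2 be a fixed integer. There exist constants c, C > 0 such that for all φ ∈ (0,π) and 0 < t ≤ 1: c·(min(t, π−φ))^{(N−1)/2} ≤ ∫_{0}^{(π−φ)/2} (γ(γ+φ))^{(N−3)/2}·exp(−γ(γ+φ)/t)·(γ+φ) dγ ≤ C·(min(t, π−φ))^{(N−1)/2}. -/
open MeasureTheory Set in
lemma aux_J (a : ℝ) (ha : 0 < a) (t : ℝ) (ht : 0 < t) :
    IntegrableOn (fun u : ℝ => u ^ (a - 1) * Real.exp (-u / t)) (Ioi 0) ∧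
    ∫ u in Ioi (0:ℝ), u ^ (a - 1) * Real.exp (-u / t) = t ^ a * Real.Gamma a := by
  have e : (fun u : ℝ => u ^ (a - 1) * Real.exp (-u / t)) =
      fun u : ℝ => u ^ (a - 1) * Real.exp (-(t⁻¹ * u)) := by
    ext u; congr 2; field_simp
  rw [e]
  constructor
  · have := integrableOn_rpow_mul_exp_neg_mul_rpow (s := a - 1) (p := 1) (b := t⁻¹)
      (by linarith) (by norm_num) (by positivity)
    simpa using this
  · have := Real.integral_rpow_mul_exp_neg_mul_Ioi ha (r := t⁻¹) (by positivity)
    simpa using this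

open MeasureTheory Set in
lemma aux_pow (a : ℝ) (ha : 0 < a) (b : ℝ) (hb : 0 < b) :
    IntegrableOn (fun u : ℝ => u ^ (a - 1)) (Ioo 0 b) ∧
    ∫ u in Ioo (0:ℝ) b, u ^ (a - 1) = b ^ a / a := by
  constructor
  · have := (intervalIntegral.intervalIntegrable_rpow' (a := 0) (b := b) (r := a - 1)
      (by linarith))
    rw [intervalIntegrable_iff_integrableOn_Ioo_of_le hb.le] at this
    exact this
  · rw [← integral_Ioc_eq_integral_Ioo, ← intervalIntegral.integral_of_le hb.le,
      integral_rpow (Or.inl (by linarith))]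
    simp [Real.zero_rpow ha.ne']

open MeasureTheory Set in
lemma aux_J_lower (a : ℝ) (ha : 0 < a) (t b s : ℝ) (ht : 0 < t) (hs : 0 < s)
    (hsb : s ≤ b) (hst : s ≤ t) :
    Real.exp (-1) * (s ^ a / a) ≤ ∫ u in Ioo (0:ℝ) b, u ^ (a - 1) * Real.exp (-u / t) := by
  have hi := (aux_J a ha t ht).1
  calc Real.exp (-1) * (s ^ a / a) = ∫ u in Ioo (0:ℝ) s, Real.exp (-1) * u ^ (a - 1) := by
        rw [integral_const_mul, (aux_pow a ha s hs).2]
    _ ≤ ∫ u in Ioo (0:ℝ) s, u ^ (a - 1) * Real.exp (-u / t) := by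
        apply setIntegral_mono_on ((aux_pow a ha s hs).1.const_mul _)
          (hi.mono_set Ioo_subset_Ioi_self) measurableSet_Ioo
        intro u hu
        rw [mul_comm]
        have : 0 ≤ u ^ (a - 1) := Real.rpow_nonneg hu.1.le _
        gcongr
        rw [le_div_iff₀ ht]
        linarith [hu.2]
    _ ≤ _ := by
        apply setIntegral_mono_set (hi.mono_set Ioo_subset_Ioi_self)
        · refine (ae_restrict_iff' measurableSet_Ioo).2 (Filter.Eventually.of_forall ?_)
          intro u hu
          have : 0 ≤ u ^ (a - 1) := Real.rpow_nonneg hu.1.le _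
          simp only [Pi.zero_apply]
          positivity
        · exact (Ioo_subset_Ioo_right hsb).eventuallyLE

open MeasureTheory Set in
lemma aux_J_upper (a : ℝ) (ha : 0 < a) (t b : ℝ) (ht : 0 < t) (hb : 0 < b) :
    (∫ u in Ioo (0:ℝ) b, u ^ (a - 1) * Real.exp (-u / t)) ≤ t ^ a * Real.Gamma a ∧
    (∫ u in Ioo (0:ℝ) b, u ^ (a - 1) * Real.exp (-u / t)) ≤ b ^ a / a := by
  have hi := (aux_J a ha t ht).1
  constructor
  · rw [← (aux_J a ha t ht).2]
    apply setIntegral_mono_set hi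
    · refine (ae_restrict_iff' measurableSet_Ioi).2 (Filter.Eventually.of_forall ?_)
      intro u hu
      have : 0 ≤ u ^ (a - 1) := Real.rpow_nonneg (le_of_lt hu) _
      simp only [Pi.zero_apply]
      positivity
    · exact Ioo_subset_Ioi_self.eventuallyLE
  · rw [← (aux_pow a ha b hb).2]
    apply setIntegral_mono_on (hi.mono_set Ioo_subset_Ioi_self) (aux_pow a ha b hb).1
      measurableSet_Ioo
    intro u hu
    have : 0 ≤ u ^ (a - 1) := Real.rpow_nonneg hu.1.le _
    apply mul_le_of_le_one_right this
    rw [Real.exp_le_one_iff]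
    exact div_nonpos_of_nonpos_of_nonneg (by linarith [hu.1]) ht.le

open MeasureTheory Set in
lemma aux_main (a : ℝ) (ha : 0 < a) (φ t B : ℝ) (hφ : 0 < φ) (ht : 0 < t) (hB : 0 < B) :
    (∫ u in Ioo (0:ℝ) (B * (B + φ)), u ^ (a - 1) * Real.exp (-u / t)) / 2 ≤
      (∫ γ in (0 : ℝ)..B, (γ * (γ + φ)) ^ (a - 1) * Real.exp (-(γ * (γ + φ)) / t) * (γ + φ)) ∧
    (∫ γ in (0 : ℝ)..B, (γ * (γ + φ)) ^ (a - 1) * Real.exp (-(γ * (γ + φ)) / t) * (γ + φ)) ≤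
      ∫ u in Ioo (0:ℝ) (B * (B + φ)), u ^ (a - 1) * Real.exp (-u / t) := by
  set g : ℝ → ℝ := fun u => u ^ (a - 1) * Real.exp (-u / t) with hg
  set f : ℝ → ℝ := fun γ => γ * (γ + φ) with hf
  have hmono : StrictMonoOn f (Icc 0 B) := by
    intro x hx y hy hxy
    simp only [hf]
    nlinarith [hx.1, hy.1]
  have hcont : ContinuousOn f (Icc 0 B) := by fun_prop
  have himg : f '' Ioo 0 B = Ioo 0 (B * (B + φ)) := by
    apply Subset.antisymm
    · rintro _ ⟨x, hx, rfl⟩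
      have h1 := hmono ⟨le_rfl, hB.le⟩ ⟨hx.1.le, hx.2.le⟩ hx.1
      have h2 := hmono ⟨hx.1.le, hx.2.le⟩ ⟨hB.le, le_rfl⟩ hx.2
      simp only [hf, zero_mul] at h1 h2 ⊢
      exact ⟨h1, h2⟩
    · have := intermediate_value_Ioo hB.le hcont
      simpa [hf] using this
  have hder : ∀ x ∈ Ioo 0 B, HasDerivWithinAt f (2 * x + φ) (Ioo 0 B) x := by
    intro x _
    have := ((hasDerivAt_id x).mul ((hasDerivAt_id x).add_const φ)).hasDerivWithinAt (s := Ioo 0 B)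
    have e : 2 * x + φ = 1 * (x + φ) + x * 1 := by ring
    rw [e]
    exact this
  have hinj : InjOn f (Ioo 0 B) := hmono.injOn.mono Ioo_subset_Icc_self
  have hgi : IntegrableOn g (f '' Ioo 0 B) := by
    rw [himg]
    exact (aux_J a ha t ht).1.mono_set Ioo_subset_Ioi_self
  have hi := (integrableOn_image_iff_integrableOn_abs_deriv_smul measurableSet_Ioo hder hinj g).1 hgi
  have hI := integral_image_eq_integral_abs_deriv_smul measurableSet_Ioo hder hinj g
  rw [himg] at hI
  rw [intervalIntegral.integral_of_le hB.le, integral_Ioc_eq_integral_Ioo, hI]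
  have hpos : ∀ x ∈ Ioo 0 B, 0 ≤ g (f x) := by
    intro x hx
    have h1 : 0 < x := hx.1
    simp only [hg, hf]
    positivity
  have hle : ∀ x ∈ Ioo 0 B, g (f x) * (x + φ) ≤ |2 * x + φ| • g (f x) := by
    intro x hx
    have := hpos x hx
    have h1 : 0 < x := hx.1
    rw [abs_of_pos (by positivity), smul_eq_mul]
    nlinarith
  have hFi : IntegrableOn (fun x => g (f x) * (x + φ)) (Ioo 0 B) := by
    refine Integrable.mono' hi ?_ ?_
    · apply Measurable.aestronglyMeasurable
      simp only [hg, hf]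
      fun_prop
    · refine (ae_restrict_iff' measurableSet_Ioo).2 (Filter.Eventually.of_forall ?_)
      intro x hx
      have h1 : 0 < x := hx.1
      rw [Real.norm_of_nonneg (mul_nonneg (hpos x hx) (by positivity))]
      exact hle x hx
  constructor
  · rw [← integral_div]
    apply setIntegral_mono_on (hi.div_const 2) hFi measurableSet_Ioo
    intro x hx
    have := hpos x hx
    have h1 : 0 < x := hx.1
    rw [abs_of_pos (by positivity), smul_eq_mul]
    change _ ≤ g (f x) * (x + φ)
    nlinarith
  · exact setIntegral_mono_on hFi hi measurableSet_Ioo hle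

/-- The final integral estimate in Section 5 of the paper:
`∫_0^{(π-φ)/2} (γ(γ+φ))^{(N-3)/2} e^{-γ(γ+φ)/t} (γ+φ) dγ ≃ (t ∧ (π-φ))^{(N-1)/2}`. -/
theorem reduction_final_integral_sharp_estimate (N : ℕ) (hN : 2 ≤ N) :
    ∃ c C : ℝ, 0 < c ∧ 0 < C ∧
      ∀ φ t : ℝ, φ ∈ Set.Ioo 0 Real.pi → 0 < t → t ≤ 1 →
        c * min t (Real.pi - φ) ^ (((N : ℝ) - 1) / 2) ≤
          (∫ γ in (0 : ℝ)..((Real.pi - φ) / 2),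
            (γ * (γ + φ)) ^ (((N : ℝ) - 3) / 2) * Real.exp (-(γ * (γ + φ)) / t) *
              (γ + φ)) ∧
        (∫ γ in (0 : ℝ)..((Real.pi - φ) / 2),
            (γ * (γ + φ)) ^ (((N : ℝ) - 3) / 2) * Real.exp (-(γ * (γ + φ)) / t) *
              (γ + φ)) ≤
          C * min t (Real.pi - φ) ^ (((N : ℝ) - 1) / 2) := by
  have hN' : (2:ℝ) ≤ N := by exact_mod_cast hN
  obtain ⟨a, hadef⟩ : ∃ a : ℝ, a = ((N : ℝ) - 1) / 2 := ⟨_, rfl⟩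
  have ha : 0 < a := by rw [hadef]; linarith
  have hGa := Real.Gamma_pos_of_pos ha
  have e3 : ((N : ℝ) - 3) / 2 = a - 1 := by rw [hadef]; ring
  rw [e3, ← hadef]
  refine ⟨Real.exp (-1) * ((1 / 2) ^ a / a) / 2, Real.Gamma a + 2 ^ a / a, by positivity,
    by positivity, ?_⟩
  intro φ t hφ ht ht1
  obtain ⟨h0, hpi⟩ := hφ
  have hp3 := Real.pi_gt_three
  have hp4 := Real.pi_le_four
  have hd : 0 < Real.pi - φ := by linarith
  obtain ⟨hl, hu⟩ := aux_main a ha φ t ((Real.pi - φ) / 2) h0 ht (by positivity)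
  have hb : 0 < (Real.pi - φ) / 2 * ((Real.pi - φ) / 2 + φ) := by positivity
  obtain ⟨hu1, hu2⟩ := aux_J_upper a ha t _ ht hb
  have hm : 0 < min t (Real.pi - φ) := lt_min ht hd
  have hl1 := aux_J_lower a ha t ((Real.pi - φ) / 2 * ((Real.pi - φ) / 2 + φ))
    (1 / 2 * min t (Real.pi - φ)) ht (by positivity)
    (by nlinarith [min_le_right t (Real.pi - φ)]) (by linarith [min_le_left t (Real.pi - φ)])
  constructor
  · refine le_trans ?_ hl
    rw [Real.mul_rpow (by norm_num) hm.le] at hl1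
    calc _ = Real.exp (-1) * ((1 / 2) ^ a * min t (Real.pi - φ) ^ a / a) / 2 := by ring
      _ ≤ _ := by linarith
  · refine le_trans hu ?_
    rcases min_cases t (Real.pi - φ) with ⟨h, _⟩ | ⟨h, _⟩
    · rw [h]
      have : 0 ≤ 2 ^ a / a * t ^ a := by positivity
      linarith
    · rw [h]
      have h1 : ((Real.pi - φ) / 2 * ((Real.pi - φ) / 2 + φ)) ^ a ≤ (2 * (Real.pi - φ)) ^ a := by
        apply Real.rpow_le_rpow hb.le _ ha.le
        nlinarith
      rw [Real.mul_rpow (by norm_num) hd.le] at h1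
      have h2 := div_le_div_of_nonneg_right h1 ha.le
      have : 0 ≤ Real.Gamma a * (Real.pi - φ) ^ a := by positivity
      calc _ ≤ _ := hu2
        _ ≤ _ := h2
        _ = 2 ^ a / a * (Real.pi - φ) ^ a := by ring
        _ ≤ _ := by linarith
end
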